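/- Let c = (c₁,…,cₙ) ∈ 𝒜⁺ be dense. Then either n = 3 and c = (1,1,1), or n is even and c alternates: c_i = 1 for all odd i ∈ {1,…,n}, or c_i = 1 for all even i ∈ {1,…,n}. -/

import Mathlib

open Matrix Finset

/-- The matrix `η(a)` with rows `(a, -1)` and `(1, 0)`. -/
def etaM (a : ℤ) : Matrix (Fin 2) (Fin 2) ℤ := !![a, -1; 1, 0]

/-- The set `𝒜⁺` of η-sequences, as an inductive predicate on lists of integers. -/
inductive IsEta : List ℤ → Prop
  | base : IsEta [0, 0]
  | rotate {c : List ℤ} : IsEta c → IsEta (c.rotate 1)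
  | reverse {c : List ℤ} : IsEta c → IsEta c.reverse
  | expand {a b : ℤ} {t : List ℤ} : IsEta (a :: b :: t) → IsEta ((a + 1) :: 1 :: (b + 1) :: t)

/-- The `i`-th entry (1-indexed) of a sequence. -/
def entryOf (c : List ℤ) (i : ℕ) : ℤ := c.getD (i - 1) 0

/-- `φ_i(j)`: `0` if `i = j`; the (2,1)-entry of `η(c_i)⋯η(c_{j-1})` if `i < j`;
the (2,1)-entry of `η(c_j)⋯η(c_{i-1})` if `j < i`.  (Indices are 1-based.) -/
def phi (c : List ℤ) (i j : ℕ) : ℤ :=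
  if i = j then 0
  else if i < j then (((c.drop (i - 1)).take (j - i)).map etaM).prod 1 0
  else (((c.drop (j - 1)).take (i - j)).map etaM).prod 1 0

open Classical in
/-- `m_i`: the set of positions `j ∈ {1,…,n}` where `φ_i` attains its maximum. -/
noncomputable def mset (c : List ℤ) (i : ℕ) : Finset ℕ :=
  (Finset.Icc 1 c.length).filter (fun j => ∀ l ∈ Finset.Icc 1 c.length, phi c i l ≤ phi c i j)

/-- `i ⊕ k`: addition of 1-based indices, wrapping around modulo `n` (for `i + k ≤ 2n`). -/
def addIdx (n i k : ℕ) : ℕ := if i + k ≤ n then i + k else i + k - n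

/-- `c` is dense if for every `i ∈ {1,…,n}`, `|m_i| > 1` or `|m_{i+1}| > 1`
(indices taken cyclically). -/
def DenseSeq (c : List ℤ) : Prop :=
  ∀ i ∈ Finset.Icc 1 c.length,
    1 < (mset c i).card ∨ 1 < (mset c (addIdx c.length i 1)).card

/-- `c` is fan-shaped if a cyclic rotation of `c` equals `(n-2, 1, 2, …, 2, 1)`. -/
def IsFan (c : List ℤ) : Prop :=
  ∃ k, c.rotate k =
    ((c.length : ℤ) - 2) :: 1 :: (List.replicate (c.length - 3) (2 : ℤ) ++ [1])

/-- The product of the matrices `η(a)` along a list. -/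
def etaProd (l : List ℤ) : Matrix (Fin 2) (Fin 2) ℤ := (l.map etaM).prod

lemma etaProd_nil : etaProd [] = 1 := rfl

lemma etaProd_cons (a : ℤ) (l : List ℤ) : etaProd (a :: l) = etaM a * etaProd l := by
  simp [etaProd]

lemma etaProd_append (l m : List ℤ) : etaProd (l ++ m) = etaProd l * etaProd m := by
  simp [etaProd]

lemma etaProd_singleton (a : ℤ) : etaProd [a] = etaM a := by
  simp [etaProd]

lemma det_etaProd (l : List ℤ) : (etaProd l).det = 1 := by
  induction l with
  | nil => simp [etaProd_nil]
  | cons a l ih => rw [etaProd_cons, Matrix.det_mul, ih, etaM, Matrix.det_fin_two_of]; simp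

lemma etaM_mul_zero_zero (a : ℤ) (A : Matrix (Fin 2) (Fin 2) ℤ) :
    (etaM a * A) 0 0 = a * A 0 0 - A 1 0 := by
  simp [etaM, Matrix.mul_apply, Fin.sum_univ_two]; ring

lemma etaM_mul_one (a : ℤ) (A : Matrix (Fin 2) (Fin 2) ℤ) (j : Fin 2) :
    (etaM a * A) 1 j = A 0 j := by
  simp [etaM, Matrix.mul_apply, Fin.sum_univ_two]

lemma mul_etaM_zero (a : ℤ) (A : Matrix (Fin 2) (Fin 2) ℤ) (i : Fin 2) :
    (A * etaM a) i 0 = a * A i 0 + A i 1 := by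
  simp [etaM, Matrix.mul_apply, Fin.sum_univ_two]; ring

lemma mul_etaM_one (a : ℤ) (A : Matrix (Fin 2) (Fin 2) ℤ) (i : Fin 2) :
    (A * etaM a) i 1 = -A i 0 := by
  simp [etaM, Matrix.mul_apply, Fin.sum_univ_two]

lemma etaM_add_one_mul (a b : ℤ) : etaM (a + 1) * (etaM 1 * etaM (b + 1)) = etaM a * etaM b := by
  ext i j
  fin_cases i <;> fin_cases j <;> simp [etaM, Matrix.mul_apply, Fin.sum_univ_two]; ring

/-- Reversing a list conjugates the transpose of its product by `diag(1, -1)`. -/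
lemma etaProd_reverse (l : List ℤ) :
    etaProd l.reverse =
      !![etaProd l 0 0, -etaProd l 1 0; -etaProd l 0 1, etaProd l 1 1] := by
  induction l with
  | nil =>
    ext i j
    fin_cases i <;> fin_cases j <;> simp [etaProd_nil]
  | cons a l ih =>
    rw [List.reverse_cons, etaProd_append, ih, etaProd_singleton, etaProd_cons]
    ext i j
    fin_cases i <;> fin_cases j <;> simp [etaM, Matrix.mul_apply, Fin.sum_univ_two] <;> ring

lemma mul_comm_eq_neg_one {A B : Matrix (Fin 2) (Fin 2) ℤ} (h : A * B = -1) : B * A = -1 := by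
  have h1 : (-A) * B = 1 := by rw [neg_mul, h, neg_neg]
  have h2 := mul_eq_one_comm.1 h1
  rw [mul_neg] at h2
  rw [← h2, neg_neg]

/-- If `A * B = -1` and `det A = 1`, then `B` is minus the adjugate of `A`. -/
lemma eq_neg_adjugate {A B : Matrix (Fin 2) (Fin 2) ℤ} (h : A * B = -1) (hA : A.det = 1) :
    B = -A.adjugate := by
  calc B = (A.adjugate * A) * B := by rw [Matrix.adjugate_mul, hA, one_smul, one_mul]
    _ = -A.adjugate := by rw [mul_assoc, h, mul_neg, mul_one]

/-- The total product is `-1` and all short enough continuants are positive. -/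
def IsPositiveCycle (c : List ℤ) : Prop :=
  2 ≤ c.length ∧ etaProd c = -1 ∧
    ∀ q, q <:+: c → q.length + 2 ≤ c.length → 0 < etaProd q 0 0

lemma etaProd_tail_zero_zero {a : ℤ} {t : List ℤ} (h : etaProd (a :: t) = -1) :
    etaProd t 0 0 = 0 := by
  have := congrFun (congrFun h 1) 0
  rwa [etaProd_cons, etaM_mul_one] at this

lemma IsPositiveCycle.rotate {c : List ℤ} (h : IsPositiveCycle c) :
    IsPositiveCycle (c.rotate 1) := by
  obtain ⟨h2, hp, hq⟩ := h
  obtain _ | ⟨a, t⟩ := c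
  · simp at h2
  rw [List.rotate_cons_succ, List.rotate_zero]
  refine ⟨by simpa using h2, ?_, ?_⟩
  · rw [etaProd_append, etaProd_singleton]
    rw [etaProd_cons] at hp
    exact mul_comm_eq_neg_one hp
  · intro q hqi hl
    rcases List.infix_concat_iff.1 hqi with hs | hi
    · rcases List.suffix_concat_iff.1 hs with rfl | ⟨s, rfl, r, rfl⟩
      · simp [etaProd_nil]
      · obtain _ | ⟨b, r⟩ := r
        · simp at hl
        rcases List.eq_nil_or_concat r with rfl | ⟨m, d, rfl⟩
        · simp at hl
        rw [etaProd_append, etaProd_singleton]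
        rw [etaProd_cons, etaProd_append] at hp
        have hp' := mul_comm_eq_neg_one hp
        rw [mul_assoc] at hp'
        rw [eq_neg_adjugate hp' (det_etaProd _), Matrix.adjugate_fin_two, List.concat_eq_append,
          etaProd_cons, etaProd_append, etaProd_singleton]
        have hm : 0 < etaProd m 0 0 := by
          apply hq m
          · exact ⟨[a, b], d :: s, by simp⟩
          · simp
        simpa [etaM_mul_one, mul_etaM_one] using hm
    · exact hq q (hi.trans (List.suffix_cons a t).isInfix) (by simpa using hl)

lemma IsPositiveCycle.reverse {c : List ℤ} (h : IsPositiveCycle c) :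
    IsPositiveCycle c.reverse := by
  obtain ⟨h2, hp, hq⟩ := h
  refine ⟨by simpa using h2, ?_, ?_⟩
  · rw [etaProd_reverse, hp]
    ext i j
    fin_cases i <;> fin_cases j <;> simp
  · intro q hqi hl
    have := hq q.reverse (by rw [← List.reverse_infix]; simpa using hqi) (by simpa using hl)
    rw [etaProd_reverse] at this
    simpa using this

lemma IsPositiveCycle.expand {a b : ℤ} {t : List ℤ} (h : IsPositiveCycle (a :: b :: t)) :
    IsPositiveCycle ((a + 1) :: 1 :: (b + 1) :: t) := by
  obtain ⟨h2, hp, hq⟩ := h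
  have key : ∀ s, etaProd ((a + 1) :: 1 :: (b + 1) :: s) = etaProd (a :: b :: s) := by
    intro s
    simp only [etaProd_cons]
    rw [← mul_assoc (etaM 1), ← mul_assoc (etaM (a + 1)), etaM_add_one_mul, mul_assoc]
  have key' : ∀ s, etaProd (1 :: (b + 1) :: s) 0 0 = etaProd (b :: s) 0 0 := by
    intro s
    simp only [etaProd_cons, etaM_mul_zero_zero, etaM_mul_one]
    ring
  have hbt : etaProd (b :: t) 0 0 = 0 := etaProd_tail_zero_zero hp
  refine ⟨by simp, (key t).trans hp, ?_⟩
  intro q hqi hl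
  simp only [List.length_cons] at hl hq
  rcases List.infix_cons_iff.1 hqi with hpre₀ | hqi
  · rcases List.prefix_cons_iff.1 hpre₀ with rfl | ⟨q, rfl, hpre₁⟩
    · simp [etaProd_nil]
    rcases List.prefix_cons_iff.1 hpre₁ with rfl | ⟨q, rfl, hpre₂⟩
    · rw [etaProd_singleton]
      by_cases ht : t = []
      · subst ht
        have h01 := congrFun (congrFun hp 0) 1
        simp [etaProd_cons, etaProd_nil, etaM] at h01 ⊢
        omega
      · have := hq [a] ⟨[], b :: t, by simp⟩ (by
          have := List.length_pos_iff.2 ht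
          simp; omega)
        simp [etaProd_cons, etaProd_nil, etaM] at this ⊢
        omega
    rcases List.prefix_cons_iff.1 hpre₂ with rfl | ⟨q, rfl, hpre₃⟩
    · have := hq [a] ⟨[], b :: t, by simp⟩ (by simp at hl ⊢; omega)
      simp [etaProd_cons, etaProd_nil, etaM] at this ⊢
      omega
    rw [key]
    apply hq
    · exact (List.cons_prefix_cons.2 ⟨rfl, List.cons_prefix_cons.2 ⟨rfl, hpre₃⟩⟩).isInfix
    · simp at hl ⊢; omega
  rcases List.infix_cons_iff.1 hqi with hpre₀ | hqi
  · rcases List.prefix_cons_iff.1 hpre₀ with rfl | ⟨q, rfl, hpre₁⟩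
    · simp [etaProd_nil]
    rcases List.prefix_cons_iff.1 hpre₁ with rfl | ⟨q, rfl, hpre₂⟩
    · simp [etaProd_singleton, etaM]
    rw [key']
    apply hq
    · exact (List.infix_cons_iff.2 (Or.inr (List.cons_prefix_cons.2 ⟨rfl, hpre₂⟩).isInfix))
    · simp at hl ⊢; omega
  have htc : t <:+: a :: b :: t := ⟨[a, b], [], by simp⟩
  rcases List.infix_cons_iff.1 hqi with hpre₀ | hqi
  · rcases List.prefix_cons_iff.1 hpre₀ with rfl | ⟨q, rfl, hpre₁⟩
    · simp [etaProd_nil]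
    have hqt : 0 < etaProd q 0 0 := hq q (hpre₁.isInfix.trans htc) (by
      have := hpre₁.length_le
      omega)
    have hb : 0 ≤ etaProd (b :: q) 0 0 := by
      by_cases hqe : q = t
      · rw [hqe, hbt]
      · refine (hq (b :: q) (List.infix_cons_iff.2
          (Or.inr (List.cons_prefix_cons.2 ⟨rfl, hpre₁⟩).isInfix)) ?_).le
        have : q.length ≠ t.length := fun h => hqe (hpre₁.eq_of_length h)
        have := hpre₁.length_le
        simp; omega
    rw [etaProd_cons, etaM_mul_zero_zero] at hb ⊢
    linarith
  · apply hq q (hqi.trans htc)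
    have := hqi.length_le
    omega

lemma IsEta.isPositiveCycle {c : List ℤ} (h : IsEta c) : IsPositiveCycle c := by
  induction h with
  | base =>
    refine ⟨by simp, ?_, ?_⟩
    · ext i j
      fin_cases i <;> fin_cases j <;> simp [etaProd, etaM]
    · intro q _ hl
      obtain rfl : q = [] := List.length_eq_zero_iff.1 (by simpa using hl)
      simp [etaProd_nil]
  | rotate _ ih => exact ih.rotate
  | reverse _ ih => exact ih.reverse
  | expand _ ih => exact ih.expand

/-- An antiperiodic sequence of vectors `(x k, y k)` with `v (k+1) = c k * v k - v (k-1)`,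
whose determinants within a period are positive. -/
structure IsFrieze (n : ℕ) (c x y : ℕ → ℤ) : Prop where
  two_le : 2 ≤ n
  x_add : ∀ k, x (k + n) = -x k
  y_add : ∀ k, y (k + n) = -y k
  c_add : ∀ k, c (k + n) = c k
  x_rec : ∀ k, x (k + 2) = c (k + 1) * x (k + 1) - x k
  y_rec : ∀ k, y (k + 2) = c (k + 1) * y (k + 1) - y k
  det_succ : ∀ k, x k * y (k + 1) - x (k + 1) * y k = 1
  det_pos : ∀ i j, i < j → j < i + n → 0 < x i * y j - x j * y i

/-- The position `j` in the window `(i, i + n)` maximizes the determinant with position `i`. -/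
def IsMaxAt (n : ℕ) (x y : ℕ → ℤ) (i j : ℕ) : Prop :=
  i < j ∧ j < i + n ∧
    ∀ k, i < k → k < i + n → x i * y k - x k * y i ≤ x i * y j - x j * y i

namespace IsFrieze

variable {n : ℕ} {c x y : ℕ → ℤ}

lemma det_last (h : IsFrieze n c x y) (i : ℕ) :
    x i * y (i + n - 1) - x (i + n - 1) * y i = 1 := by
  have h2 := h.two_le
  have h1 := h.det_succ (i + n - 1)
  rw [show i + n - 1 + 1 = i + n by omega, h.x_add, h.y_add] at h1
  linarith

lemma c_add_mul (h : IsFrieze n c x y) (k m : ℕ) : c (k + n * m) = c k := by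
  induction m with
  | zero => simp
  | succ m ih => rw [Nat.mul_succ, ← Nat.add_assoc, h.c_add, ih]

lemma isMaxAt_add_iff (h : IsFrieze n c x y) (i j : ℕ) :
    IsMaxAt n x y (i + n) (j + n) ↔ IsMaxAt n x y i j := by
  constructor
  · rintro ⟨h1, h2, h3⟩
    refine ⟨by omega, by omega, fun k hk hk' => ?_⟩
    have := h3 (k + n) (by omega) (by omega)
    simp only [h.x_add, h.y_add] at this
    linarith
  · rintro ⟨h1, h2, h3⟩
    refine ⟨by omega, by omega, fun k hk hk' => ?_⟩
    obtain ⟨k, rfl⟩ : ∃ k', k = k' + n := ⟨k - n, by omega⟩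
    have := h3 k (by omega) (by omega)
    simp only [h.x_add, h.y_add]
    linarith

lemma exists_isMaxAt (h : IsFrieze n c x y) (i : ℕ) : ∃ j, IsMaxAt n x y i j := by
  have h2 := h.two_le
  obtain ⟨j, hj, hm⟩ := Finset.exists_max_image (Finset.Ioo i (i + n))
    (fun k => x i * y k - x k * y i) ⟨i + 1, by simp; omega⟩
  rw [Finset.mem_Ioo] at hj
  exact ⟨j, hj.1, hj.2, fun k hk hk' => hm k (Finset.mem_Ioo.2 ⟨hk, hk'⟩)⟩

lemma isMaxAt_mono (h : IsFrieze n c x y) {i j k : ℕ} (hj : IsMaxAt n x y i j)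
    (hk : IsMaxAt n x y (i + 1) k) : j ≤ k := by
  by_contra! hlt
  obtain ⟨j1, j2, j3⟩ := hj
  obtain ⟨k1, k2, k3⟩ := hk
  have a1 := j3 k (by omega) (by omega)
  have a2 := k3 j (by omega) (by omega)
  have p1 := h.det_pos i k (by omega) (by omega)
  have p2 := h.det_pos (i + 1) j (by omega) (by omega)
  have p3 := h.det_pos k j (by omega) (by omega)
  have e := h.det_succ i
  have plucker : (x i * y k - x k * y i) * (x (i + 1) * y j - x j * y (i + 1)) =
      (x i * y (i + 1) - x (i + 1) * y i) * (x k * y j - x j * y k) +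
      (x i * y j - x j * y i) * (x (i + 1) * y k - x k * y (i + 1)) := by ring
  rw [e, one_mul] at plucker
  have := mul_le_mul a1 a2 p2.le (p1.le.trans a1)
  linarith

lemma eq_one_of_adjacent (h : IsFrieze n c x y) {i j : ℕ} (hij : i < j) (hj : j < i + n)
    (he : x i * y j - x j * y i = x i * y (j + 1) - x (j + 1) * y i) :
    x i * y j - x j * y i = 1 := by
  have pos := h.det_pos i j hij hj
  have e1 := h.det_succ i
  have e2 := h.det_succ j
  have hd : x i * y j - x j * y i ∣ 1 := by
    refine ⟨(x (i + 1) * y (j + 1) - x (j + 1) * y (i + 1)) -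
      (x (i + 1) * y j - x j * y (i + 1)), ?_⟩
    linear_combination (x (i + 1) * y j - x j * y (i + 1)) * he -
      (x j * y (j + 1) - x (j + 1) * y j) * e1 - e2
  exact Int.eq_one_of_dvd_one pos.le hd

lemma det_rec (h : IsFrieze n c x y) (i k : ℕ) :
    (x i * y k - x k * y i) + (x i * y (k + 2) - x (k + 2) * y i) =
      c (k + 1) * (x i * y (k + 1) - x (k + 1) * y i) := by
  rw [h.x_rec, h.y_rec]; ring

/-- A first maximum is the tip of an ear. -/
lemma c_eq_one (h : IsFrieze n c x y) (hn : 3 ≤ n) {i j : ℕ} (hj : IsMaxAt n x y i j)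
    (hmin : ∀ k, IsMaxAt n x y i k → j ≤ k) : c j = 1 := by
  obtain ⟨j1, j2, j3⟩ := hj
  by_cases hM : x i * y j - x j * y i = 1
  · have hmax1 : IsMaxAt n x y i (i + 1) := by
      refine ⟨by omega, by omega, fun k hk hk' => ?_⟩
      have := j3 k hk hk'
      rw [h.det_succ]
      linarith
    obtain rfl : j = i + 1 := by have := hmin _ hmax1; omega
    have h1 := j3 (i + 2) (by omega) (by omega)
    have h2 := h.det_pos i (i + 2) (by omega) (by omega)
    have h3 := h.det_rec i i
    rw [hM] at h1 h3
    have : x i * y i - x i * y i = 0 := sub_self _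
    linarith
  · have hj1 : j ≠ i + 1 := by
      rintro rfl
      exact hM (h.det_succ i)
    have hj2 : j ≠ i + n - 1 := by
      rintro rfl
      exact hM (h.det_last i)
    obtain ⟨k, rfl⟩ : ∃ k, j = k + 1 := ⟨j - 1, by omega⟩
    have r := h.det_rec i k
    have a1 := j3 k (by omega) (by omega)
    have a2 := j3 (k + 2) (by omega) (by omega)
    have p := h.det_pos i (k + 1) (by omega) (by omega)
    have p1 := h.det_pos i k (by omega) (by omega)
    have p2 := h.det_pos i (k + 2) (by omega) (by omega)
    have n2 : x i * y (k + 1) - x (k + 1) * y i ≠ x i * y (k + 2) - x (k + 2) * y i :=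
      fun he => hM (h.eq_one_of_adjacent (by omega) (by omega) he)
    have a2' := lt_of_le_of_ne a2 n2.symm
    have c0 : 0 < c (k + 1) := by
      by_contra! hc
      nlinarith
    have c2 : c (k + 1) < 2 := by
      by_contra! hc
      nlinarith
    omega

/-- If the maximum is attained twice, then it is attained at non-adjacent positions. -/
lemma exists_wide (h : IsFrieze n c x y) (hn : 4 ≤ n) {i j k : ℕ} (hj : IsMaxAt n x y i j)
    (hk : IsMaxAt n x y i k) (hjk : j < k) :
    ∃ j k, IsMaxAt n x y i j ∧ IsMaxAt n x y i k ∧ j + 2 ≤ k := by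
  by_cases hw : j + 2 ≤ k
  · exact ⟨j, k, hj, hk, hw⟩
  obtain rfl : k = j + 1 := by omega
  obtain ⟨j1, j2, j3⟩ := hj
  obtain ⟨k1, k2, k3⟩ := hk
  have hM := h.eq_one_of_adjacent j1 j2 (le_antisymm (k3 j j1 j2) (j3 _ k1 k2))
  rw [hM] at j3
  refine ⟨i + 1, i + n - 1, ⟨by omega, by omega, ?_⟩, ⟨by omega, by omega, ?_⟩, by omega⟩
  · rwa [h.det_succ]
  · rwa [h.det_last]

lemma isMaxAt_add_mul_iff (h : IsFrieze n c x y) (i j m : ℕ) :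
    IsMaxAt n x y (i + n * m) (j + n * m) ↔ IsMaxAt n x y i j := by
  induction m with
  | zero => simp
  | succ m ih => rw [Nat.mul_succ, ← Nat.add_assoc, ← Nat.add_assoc, h.isMaxAt_add_iff, ih]

/-- If among any two adjacent positions one has several maxima, then `n` is even and `c k = 1`
for all `k` of some fixed parity. -/
lemma alternating (h : IsFrieze n c x y) (hn : 4 ≤ n)
    (hd : ∀ i, (∃ j k, IsMaxAt n x y i j ∧ IsMaxAt n x y i k ∧ j < k) ∨
      ∃ j k, IsMaxAt n x y (i + 1) j ∧ IsMaxAt n x y (i + 1) k ∧ j < k) :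
    Even n ∧ ∃ p, ∀ k, k % 2 = p % 2 → c k = 1 := by
  classical
  let f : ℕ → ℕ := fun i => Nat.find (h.exists_isMaxAt i)
  have f_spec : ∀ i, IsMaxAt n x y i (f i) := fun i => Nat.find_spec (h.exists_isMaxAt i)
  have f_min : ∀ i k, IsMaxAt n x y i k → f i ≤ k := fun i k hk => Nat.find_min' _ hk
  have f_add : ∀ i, f (i + n) = f i + n := by
    intro i
    apply le_antisymm (f_min _ _ ((h.isMaxAt_add_iff i (f i)).2 (f_spec i)))
    have h1 := f_spec (i + n)
    obtain ⟨k, hk⟩ : ∃ k, f (i + n) = k + n := ⟨f (i + n) - n, by have := h1.1; omega⟩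
    rw [hk] at h1 ⊢
    have := f_min i k ((h.isMaxAt_add_iff i k).1 h1)
    omega
  have f_mono : ∀ i, f i ≤ f (i + 1) := fun i => h.isMaxAt_mono (f_spec i) (f_spec (i + 1))
  have f_mono' : ∀ i, f (i + 1) ≤ f (i + 2) := fun i => f_mono (i + 1)
  have f_wide : ∀ i, (∃ j k, IsMaxAt n x y i j ∧ IsMaxAt n x y i k ∧ j < k) →
      f i + 2 ≤ f (i + 1) := by
    rintro i ⟨j, k, hj, hk, hjk⟩
    obtain ⟨j, k, hj, hk, hjk⟩ := h.exists_wide hn hj hk hjk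
    have := f_min i j hj
    have := h.isMaxAt_mono hk (f_spec (i + 1))
    omega
  have step : ∀ i, f i + 2 ≤ f (i + 1) ∨ f (i + 1) + 2 ≤ f (i + 2) := fun i =>
    (hd i).imp (f_wide i) (f_wide (i + 1))
  have f_two : ∀ i m, f i + 2 * m ≤ f (i + 2 * m) := by
    intro i m
    induction m with
    | zero => simp
    | succ m ih =>
      have h1 := step (i + 2 * m)
      have h2 := f_mono (i + 2 * m)
      have h3 := f_mono' (i + 2 * m)
      rw [show i + 2 * (m + 1) = i + 2 * m + 2 by ring]
      omega
  have f_eq : ∀ i, f (i + 2) = f i + 2 := by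
    intro i
    have h1 := f_two (i + 2) (n - 1)
    have h2 := f_mono i
    have h3 := f_mono' i
    have h4 := step i
    rw [show i + 2 + 2 * (n - 1) = i + n + n by omega, f_add, f_add] at h1
    omega
  have parity : ∀ i, f i % 2 = f 0 % 2 := by
    intro i
    induction i with
    | zero => rfl
    | succ i ih =>
      have h1 := step i
      have h2 := f_eq i
      have h3 := f_mono i
      have h4 := f_mono' i
      omega
  have f_even : ∀ m, f (2 * m) = f 0 + 2 * m := by
    intro m
    induction m with
    | zero => rfl
    | succ m ih => rw [show 2 * (m + 1) = 2 * m + 2 by ring, f_eq, ih]; ring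
  have ear : ∀ i, c (f i) = 1 := fun i => h.c_eq_one (by omega) (f_spec i) (f_min i)
  have even_n : n % 2 = 0 := by
    have h1 := parity n
    have h2 := f_add 0
    rw [Nat.zero_add] at h2
    omega
  refine ⟨Nat.even_iff.2 even_n, f 0, fun k hk => ?_⟩
  rw [← h.c_add_mul k (f 0)]
  have hle : f 0 ≤ n * f 0 := Nat.le_mul_of_pos_left _ (by omega)
  have hev : (n * f 0) % 2 = 0 := by rw [Nat.mul_mod, even_n]; simp
  rw [show k + n * f 0 = f (2 * ((k + n * f 0 - f 0) / 2)) by rw [f_even]; omega]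
  exact ear _

end IsFrieze

/-- The periodic extension of a list. -/
def periodicExt (c : List ℤ) (k : ℕ) : ℤ := c.getD (k % c.length) 0

/-- The partial products of the periodic extension of a list. -/
def partialProd (c : List ℤ) : ℕ → Matrix (Fin 2) (Fin 2) ℤ
  | 0 => 1
  | k + 1 => partialProd c k * etaM (periodicExt c k)

lemma partialProd_eq_take (c : List ℤ) {k : ℕ} (hk : k ≤ c.length) :
    partialProd c k = etaProd (c.take k) := by
  induction k with
  | zero => simp [partialProd, etaProd_nil]
  | succ k ih =>
    rw [partialProd, ih (by omega), List.take_add_one, etaProd_append, periodicExt,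
      Nat.mod_eq_of_lt (by omega), List.getD_eq_getElem _ _ (by omega),
      List.getElem?_eq_getElem (by omega), Option.toList_some, etaProd_singleton]

lemma det_partialProd (c : List ℤ) (k : ℕ) : (partialProd c k).det = 1 := by
  induction k with
  | zero => simp [partialProd]
  | succ k ih => simp [partialProd, Matrix.det_mul, ih, etaM, Matrix.det_fin_two]

lemma periodicExt_add (c : List ℤ) (k : ℕ) : periodicExt c (k + c.length) = periodicExt c k := by
  simp [periodicExt]

lemma partialProd_add {c : List ℤ} (h : etaProd c = -1) (k : ℕ) :
    partialProd c (k + c.length) = -partialProd c k := by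
  induction k with
  | zero => rw [Nat.zero_add, partialProd_eq_take c le_rfl, List.take_length, h]; rfl
  | succ k ih =>
    rw [show k + 1 + c.length = k + c.length + 1 by ring, partialProd, ih, periodicExt_add,
      partialProd, neg_mul]

lemma etaProd_drop_take (c : List ℤ) {i j : ℕ} (hij : i ≤ j) (hj : j ≤ c.length) :
    etaProd ((c.drop i).take (j - i)) 1 0 =
      partialProd c i 0 0 * partialProd c j 1 0 - partialProd c j 0 0 * partialProd c i 1 0 := by
  have h1 : partialProd c j = partialProd c i * etaProd ((c.drop i).take (j - i)) := by
    rw [partialProd_eq_take c hj, partialProd_eq_take c (hij.trans hj), ← etaProd_append,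
      ← List.take_add, Nat.add_sub_cancel' hij]
  have h2 := det_partialProd c i
  rw [Matrix.det_fin_two] at h2
  rw [h1]
  simp only [Matrix.mul_apply, Fin.sum_univ_two]
  linear_combination (-etaProd ((c.drop i).take (j - i)) 1 0) * h2

lemma IsPositiveCycle.isFrieze {c : List ℤ} (h : IsPositiveCycle c) :
    IsFrieze c.length (periodicExt c) (fun k => partialProd c k 0 0)
      (fun k => partialProd c k 1 0) := by
  obtain ⟨h2, hp, hq⟩ := h
  have hadd := partialProd_add hp
  have base : ∀ i j, i < j → j < c.length → 0 <
      partialProd c i 0 0 * partialProd c j 1 0 - partialProd c j 0 0 * partialProd c i 1 0 := by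
    intro i j hij hj
    rw [← etaProd_drop_take c hij.le hj.le, List.drop_eq_getElem_cons (by omega),
      show j - i = (j - i - 1) + 1 by omega, List.take_succ_cons, etaProd_cons, etaM_mul_one]
    apply hq
    · exact (List.take_prefix _ _).isInfix.trans (List.drop_suffix _ _).isInfix
    · rw [List.length_take]; omega
  have window : ∀ i j, i < c.length → i < j → j < i + c.length → 0 <
      partialProd c i 0 0 * partialProd c j 1 0 - partialProd c j 0 0 * partialProd c i 1 0 := by
    intro i j hi hij hj
    by_cases hjn : j < c.length
    · exact base i j hij hjn
    · obtain ⟨j, rfl⟩ : ∃ k, j = k + c.length := ⟨j - c.length, by omega⟩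
      have := base j i (by omega) hi
      rw [hadd, Matrix.neg_apply, Matrix.neg_apply]
      linarith
  have shift : ∀ m i j, i < c.length → i < j → j < i + c.length → 0 <
      partialProd c (i + c.length * m) 0 0 * partialProd c (j + c.length * m) 1 0 -
      partialProd c (j + c.length * m) 0 0 * partialProd c (i + c.length * m) 1 0 := by
    intro m i j hi hij hj
    induction m with
    | zero => simpa using window i j hi hij hj
    | succ m ih =>
      rw [Nat.mul_succ, ← Nat.add_assoc, ← Nat.add_assoc, hadd, hadd]
      simp only [Matrix.neg_apply]
      linarith
  refine ⟨h2, fun k => by simp [hadd], fun k => by simp [hadd], periodicExt_add c, ?_, ?_, ?_, ?_⟩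
  · intro k
    simp only [partialProd, mul_etaM_zero, mul_etaM_one]
    ring
  · intro k
    simp only [partialProd, mul_etaM_zero, mul_etaM_one]
    ring
  · intro k
    have := det_partialProd c k
    rw [Matrix.det_fin_two] at this
    simp only [partialProd, mul_etaM_zero]
    linarith
  · intro i j hij hj
    have hm := Nat.mod_add_div i c.length
    have := shift (i / c.length) (i % c.length) (j - c.length * (i / c.length))
      (Nat.mod_lt _ (by omega)) (by omega) (by omega)
    rwa [hm, Nat.sub_add_cancel (by omega)] at this

lemma phi_eq_det (c : List ℤ) {i j : ℕ} (hij : i < j) (hj : j < c.length) :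
    phi c (i + 1) (j + 1) =
      partialProd c i 0 0 * partialProd c j 1 0 - partialProd c j 0 0 * partialProd c i 1 0 := by
  rw [← etaProd_drop_take c hij.le hj.le, phi, if_neg (by omega), if_pos (by omega)]
  simp [etaProd]

lemma phi_comm (c : List ℤ) (i j : ℕ) : phi c i j = phi c j i := by
  unfold phi
  rcases lt_trichotomy i j with h | h | h
  · rw [if_neg h.ne, if_pos h, if_neg h.ne', if_neg h.not_gt]
  · rw [if_pos h, if_pos h.symm]
  · rw [if_neg h.ne', if_neg h.not_gt, if_neg h.ne, if_pos h]

/-- The position in the window `(i, i + n)` corresponding to the 1-based index `j ≠ i + 1`. -/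
def windowPos (n i j : ℕ) : ℕ := if i + 1 < j then j - 1 else j - 1 + n

lemma phi_eq_windowPos {c : List ℤ} (hc : etaProd c = -1) {i j : ℕ} (hi : i < c.length)
    (hj : j ∈ Finset.Icc 1 c.length) (hij : j ≠ i + 1) :
    phi c (i + 1) j =
      partialProd c i 0 0 * partialProd c (windowPos c.length i j) 1 0 -
      partialProd c (windowPos c.length i j) 0 0 * partialProd c i 1 0 := by
  rw [Finset.mem_Icc] at hj
  obtain ⟨j, rfl⟩ : ∃ k, j = k + 1 := ⟨j - 1, by omega⟩
  unfold windowPos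
  split_ifs with h
  · rw [phi_eq_det c (by omega) (by omega), Nat.add_sub_cancel]
  · rw [phi_comm, phi_eq_det c (by omega) hi, Nat.add_sub_cancel, partialProd_add hc]
    simp only [Matrix.neg_apply]
    ring

lemma mem_mset {c : List ℤ} {i j : ℕ} :
    j ∈ mset c i ↔ j ∈ Finset.Icc 1 c.length ∧
      ∀ l ∈ Finset.Icc 1 c.length, phi c i l ≤ phi c i j := by
  simp only [mset, Finset.mem_filter]

lemma isMaxAt_windowPos {c : List ℤ} (h : IsPositiveCycle c) {i j : ℕ} (hi : i < c.length)
    (hj : j ∈ mset c (i + 1)) :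
    j ≠ i + 1 ∧ IsMaxAt c.length (fun k => partialProd c k 0 0)
      (fun k => partialProd c k 1 0) i (windowPos c.length i j) := by
  have h2 := h.1
  have hf := h.isFrieze
  obtain ⟨hj, hmax⟩ := mem_mset.1 hj
  have surj : ∀ k, i < k → k < i + c.length →
      ∃ l ∈ Finset.Icc 1 c.length, l ≠ i + 1 ∧ windowPos c.length i l = k := by
    intro k hk hk'
    by_cases hkn : k < c.length
    · exact ⟨k + 1, by simp; omega, by omega, by rw [windowPos]; split_ifs <;> omega⟩
    · exact ⟨k + 1 - c.length, by simp; omega, by omega, by rw [windowPos]; split_ifs <;> omega⟩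
  have hne : j ≠ i + 1 := by
    rintro rfl
    obtain ⟨l, hl, hl', hw⟩ := surj (i + 1) (by omega) (by omega)
    have h1 := hmax l hl
    rw [phi_eq_windowPos h.2.1 hi hl hl', hw] at h1
    have h3 := hf.det_succ i
    simp only [phi, if_true] at h1
    simp only [h3] at h1
    omega
  refine ⟨hne, ?_, ?_, ?_⟩
  · rw [Finset.mem_Icc] at hj
    rw [windowPos]; split_ifs <;> omega
  · rw [Finset.mem_Icc] at hj
    rw [windowPos]; split_ifs <;> omega
  · intro k hk hk'
    obtain ⟨l, hl, hl', rfl⟩ := surj k hk hk'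
    have h1 := hmax l hl
    rwa [phi_eq_windowPos h.2.1 hi hl hl', phi_eq_windowPos h.2.1 hi hj hne] at h1

lemma exists_isMaxAt_lt {c : List ℤ} (h : IsPositiveCycle c) {i : ℕ} (hi : i < c.length)
    (hm : 1 < (mset c (i + 1)).card) :
    ∃ j k, IsMaxAt c.length (fun k => partialProd c k 0 0) (fun k => partialProd c k 1 0) i j ∧
      IsMaxAt c.length (fun k => partialProd c k 0 0) (fun k => partialProd c k 1 0) i k ∧
      j < k := by
  obtain ⟨j, hj, k, hk, hjk⟩ := Finset.one_lt_card.1 hm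
  obtain ⟨hj1, hj2⟩ := isMaxAt_windowPos h hi hj
  obtain ⟨hk1, hk2⟩ := isMaxAt_windowPos h hi hk
  have hj3 := Finset.mem_Icc.1 (mem_mset.1 hj).1
  have hk3 := Finset.mem_Icc.1 (mem_mset.1 hk).1
  have hne : windowPos c.length i j ≠ windowPos c.length i k := by
    unfold windowPos
    split_ifs <;> omega
  rcases lt_or_gt_of_ne hne with hlt | hlt
  · exact ⟨_, _, hj2, hk2, hlt⟩
  · exact ⟨_, _, hk2, hj2, hlt⟩

lemma DenseSeq.exists_isMaxAt_lt {c : List ℤ} (h : IsPositiveCycle c) (hd : DenseSeq c) (i : ℕ) :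
    (∃ j k, IsMaxAt c.length (fun k => partialProd c k 0 0) (fun k => partialProd c k 1 0) i j ∧
      IsMaxAt c.length (fun k => partialProd c k 0 0) (fun k => partialProd c k 1 0) i k ∧
      j < k) ∨
    ∃ j k, IsMaxAt c.length (fun k => partialProd c k 0 0) (fun k => partialProd c k 1 0)
        (i + 1) j ∧
      IsMaxAt c.length (fun k => partialProd c k 0 0) (fun k => partialProd c k 1 0) (i + 1) k ∧
      j < k := by
  have h2 := h.1
  have hf := h.isFrieze
  have hlt : i % c.length < c.length := Nat.mod_lt _ (by omega)
  have hmod := Nat.mod_add_div i c.length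
  rcases hd (i % c.length + 1) (by simp; omega) with hm | hm
  · left
    obtain ⟨j, k, hj, hk, hjk⟩ := _root_.exists_isMaxAt_lt h hlt hm
    refine ⟨j + c.length * (i / c.length), k + c.length * (i / c.length), ?_, ?_, by omega⟩
    · have := (hf.isMaxAt_add_mul_iff _ _ (i / c.length)).2 hj
      rwa [hmod] at this
    · have := (hf.isMaxAt_add_mul_iff _ _ (i / c.length)).2 hk
      rwa [hmod] at this
  · right
    unfold addIdx at hm
    split_ifs at hm with hc
    · obtain ⟨j, k, hj, hk, hjk⟩ := _root_.exists_isMaxAt_lt h (by omega) hm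
      refine ⟨j + c.length * (i / c.length), k + c.length * (i / c.length), ?_, ?_, by omega⟩
      · have := (hf.isMaxAt_add_mul_iff _ _ (i / c.length)).2 hj
        rwa [show i % c.length + 1 + c.length * (i / c.length) = i + 1 by omega] at this
      · have := (hf.isMaxAt_add_mul_iff _ _ (i / c.length)).2 hk
        rwa [show i % c.length + 1 + c.length * (i / c.length) = i + 1 by omega] at this
    · rw [show i % c.length + 1 + 1 - c.length = 0 + 1 by omega] at hm
      obtain ⟨j, k, hj, hk, hjk⟩ := _root_.exists_isMaxAt_lt h (by omega) hm
      have hi : 0 + c.length * (i / c.length + 1) = i + 1 := by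
        rw [Nat.mul_succ]; omega
      refine ⟨j + c.length * (i / c.length + 1), k + c.length * (i / c.length + 1), ?_, ?_,
        by omega⟩
      · have := (hf.isMaxAt_add_mul_iff _ _ (i / c.length + 1)).2 hj
        rwa [hi] at this
      · have := (hf.isMaxAt_add_mul_iff _ _ (i / c.length + 1)).2 hk
        rwa [hi] at this

theorem dense_alternating (c : List ℤ) (h : IsEta c) (hd : DenseSeq c) :
    (c.length = 3 ∧ c = [1, 1, 1]) ∨
    (Even c.length ∧
      ((∀ i ∈ Finset.Icc 1 c.length, Odd i → entryOf c i = 1) ∨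
       (∀ i ∈ Finset.Icc 1 c.length, Even i → entryOf c i = 1))) := by
  have hp := h.isPositiveCycle
  have hf := hp.isFrieze
  have hd' := DenseSeq.exists_isMaxAt_lt hp hd
  obtain hn | hn | hn : c.length = 2 ∨ c.length = 3 ∨ 4 ≤ c.length := by
    have := hp.1
    omega
  · rcases hd' 0 with ⟨j, k, ⟨hj1, hj2, -⟩, ⟨hk1, hk2, -⟩, hjk⟩ |
      ⟨j, k, ⟨hj1, hj2, -⟩, ⟨hk1, hk2, -⟩, hjk⟩ <;> omega
  · left
    refine ⟨hn, ?_⟩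
    have ear : ∀ k, periodicExt c (k + 1) = 1 := by
      intro k
      have h1 := hf.det_rec k k
      have h2 := hf.det_last k
      rw [hf.det_succ, show k + 2 = k + c.length - 1 by omega, h2, sub_self] at h1
      linarith
    have e0 := ear 2
    have e1 := ear 0
    have e2 := ear 1
    obtain ⟨a, b, d, rfl⟩ := List.length_eq_three.1 hn
    simp [periodicExt] at e0 e1 e2
    simp [e0, e1, e2]
  · right
    obtain ⟨he, p, hpar⟩ := hf.alternating hn hd'
    refine ⟨he, ?_⟩
    have entry : ∀ i ∈ Finset.Icc 1 c.length, (i - 1) % 2 = p % 2 → entryOf c i = 1 := by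
      intro i hi hip
      rw [Finset.mem_Icc] at hi
      have := hpar (i - 1) hip
      rwa [periodicExt, Nat.mod_eq_of_lt (by omega)] at this
    rcases Nat.mod_two_eq_zero_or_one p with hp0 | hp1
    · left
      intro i hi ho
      have := Nat.odd_iff.1 ho
      exact entry i hi (by omega)
    · right
      intro i hi hev
      have := Nat.even_iff.1 hev
      rw [Finset.mem_Icc] at hi
      exact entry i (Finset.mem_Icc.2 hi) (by omega)
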